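/- Let n ≥ 1 and m : Finset (Fin n) → ℝ with m(∅) = 0 and m(S) = 0 whenever |S| ≥ 3 (a 2-additive Möbius representation). Define μ : Finset (Fin n) → ℝ by μ(T) = Σ_{S ⊆ T} m(S). Then: (i) μ is monotone (μ(R) ≤ μ(T) whenever R ⊆ T) if and only if for every i ∈ Fin n and every T ⊆ Fin n with i ∉ T, m({i}) + Σ_{j ∈ T} m({i,j}) ≥ 0; and (ii) μ(Fin n) = Σ_i m({i}) + Σ_{i<j} m({i,j}), so μ(Fin n) = 1 if and only if Σ_i m({i}) + Σ_{i<j} m({i,j}) = 1. -/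

import Mathlib

/-- The capacity induced by a Möbius representation `m`: `μ T = ∑_{S ⊆ T} m S`. -/
noncomputable def capacityOfMobius {n : ℕ} (m : Finset (Fin n) → ℝ)
    (T : Finset (Fin n)) : ℝ :=
  ∑ S ∈ T.powerset, m S

/-- A set function vanishing on sets with at least two elements has its subset sums supported on
the empty set and the singletons. -/
theorem sum_powerset_of_card_le_one {α : Type*} [DecidableEq α] (g : Finset α → ℝ)
    (hg : ∀ S : Finset α, 2 ≤ S.card → g S = 0) (T : Finset α) :
    ∑ S ∈ T.powerset, g S = g ∅ + ∑ j ∈ T, g {j} := by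
  induction T using Finset.induction_on with
  | empty => simp
  | insert a s ha ih =>
    have h : ∑ t ∈ s.powerset, g (insert a t) = g {a} := by
      rw [Finset.sum_eq_single ∅]
      · simp
      · intro t ht hne
        apply hg
        rw [Finset.card_insert_of_notMem fun h => ha (Finset.mem_powerset.1 ht h)]
        have := Finset.card_pos.2 (Finset.nonempty_iff_ne_empty.2 hne)
        omega
      · simp
    rw [Finset.sum_powerset_insert ha, ih, h, Finset.sum_insert ha]
    ring

/-- The marginal contribution of a criterion to a 2-additive capacity. -/
theorem capacityOfMobius_insert {n : ℕ} (m : Finset (Fin n) → ℝ)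
    (h2add : ∀ S : Finset (Fin n), 3 ≤ S.card → m S = 0)
    {i : Fin n} {T : Finset (Fin n)} (hi : i ∉ T) :
    capacityOfMobius m (insert i T) =
      capacityOfMobius m T + (m {i} + ∑ j ∈ T, m {i, j}) := by
  unfold capacityOfMobius
  rw [Finset.sum_powerset_insert hi]
  congr 1
  have h := sum_powerset_of_card_le_one (fun S => if i ∈ S then 0 else m (insert i S))
    (fun S hS => by
      split_ifs with h
      · rfl
      · apply h2add
        rw [Finset.card_insert_of_notMem h]
        omega) T
  have hl : ∀ S ∈ T.powerset, (if i ∈ S then 0 else m (insert i S)) = m (insert i S) :=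
    fun S hS => if_neg fun h => hi (Finset.mem_powerset.1 hS h)
  have hr : ∀ j ∈ T, (if i ∈ ({j} : Finset (Fin n)) then 0 else m (insert i {j})) = m {i, j} := by
    intro j hj
    rw [if_neg]
    rw [Finset.mem_singleton]
    rintro rfl
    exact hi hj
  rw [Finset.sum_congr rfl hl, Finset.sum_congr rfl hr] at h
  simpa using h

/-- A 2-additive capacity as a sum over singletons and ordered pairs. -/
theorem capacityOfMobius_eq_sum_pairs {n : ℕ} (m : Finset (Fin n) → ℝ) (hm0 : m ∅ = 0)
    (h2add : ∀ S : Finset (Fin n), 3 ≤ S.card → m S = 0) (T : Finset (Fin n)) :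
    capacityOfMobius m T =
      ∑ i ∈ T, m {i} + ∑ i ∈ T, ∑ j ∈ T, if i < j then m {i, j} else 0 := by
  induction T using Finset.induction_on_max with
  | empty => simp [capacityOfMobius, hm0]
  | insert a s hs ih =>
    have ha : a ∉ s := fun h => lt_irrefl a (hs a h)
    have hz : ∑ j ∈ s, (if a < j then m {a, j} else 0) = 0 :=
      Finset.sum_eq_zero fun j hj => if_neg (hs j hj).not_gt
    have hp : ∑ j ∈ s, (if j < a then m {j, a} else 0) = ∑ j ∈ s, m {a, j} :=
      Finset.sum_congr rfl fun j hj => by rw [if_pos (hs j hj), Finset.pair_comm]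
    rw [capacityOfMobius_insert m h2add ha, ih]
    simp only [Finset.sum_insert ha, Finset.sum_add_distrib, hz, hp, lt_irrefl, if_false]
    ring

/-- For a 2-additive Möbius representation `m` (with `m ∅ = 0` and `m S = 0` whenever
`|S| ≥ 3`) and the induced capacity `μ T = ∑_{S ⊆ T} m S`:
(i) `μ` is monotone iff `m {i} + ∑_{j ∈ T} m {i,j} ≥ 0` for every `i` and every
`T` with `i ∉ T`; and
(ii) `μ (univ) = ∑ i, m {i} + ∑_{i<j} m {i,j}`, hence `μ (univ) = 1` iff this sum is 1. -/
theorem twoAdditive_capacity_monotone_normalized {n : ℕ} (hn : 1 ≤ n)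
    (m : Finset (Fin n) → ℝ) (hm0 : m ∅ = 0)
    (h2add : ∀ S : Finset (Fin n), 3 ≤ S.card → m S = 0) :
    ((∀ R T : Finset (Fin n), R ⊆ T → capacityOfMobius m R ≤ capacityOfMobius m T) ↔
      (∀ (i : Fin n) (T : Finset (Fin n)), i ∉ T → 0 ≤ m {i} + ∑ j ∈ T, m {i, j})) ∧
    (capacityOfMobius m Finset.univ =
      ∑ i : Fin n, m {i} +
        ∑ p ∈ Finset.univ.filter (fun p : Fin n × Fin n => p.1 < p.2), m {p.1, p.2}) ∧
    (capacityOfMobius m Finset.univ = 1 ↔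
      ∑ i : Fin n, m {i} +
        ∑ p ∈ Finset.univ.filter (fun p : Fin n × Fin n => p.1 < p.2), m {p.1, p.2} = 1) := by
  have huniv : capacityOfMobius m Finset.univ =
      ∑ i : Fin n, m {i} +
        ∑ p ∈ Finset.univ.filter (fun p : Fin n × Fin n => p.1 < p.2), m {p.1, p.2} := by
    rw [capacityOfMobius_eq_sum_pairs m hm0 h2add, Finset.sum_filter, Fintype.sum_prod_type]
  refine ⟨⟨fun hmono i T hi => ?_, fun h R T hRT => ?_⟩, huniv, by rw [huniv]⟩
  · have := hmono T (insert i T) (Finset.subset_insert i T)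
    rw [capacityOfMobius_insert m h2add hi] at this
    linarith
  · refine (Finset.monotone_iff_forall_le_insert (f := capacityOfMobius m)).2 ?_ hRT
    intro T i hi
    rw [capacityOfMobius_insert m h2add hi]
    linarith [h i T hi]
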